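/- Let X, M be real Banach spaces, U ⊂ X and O ⊂ M open, J : U × O → ℝ with J(·,μ) ∈ C²(U) for each μ, ∂_X J continuous on U × O into X', u₀ ∈ U with ∂_X J(u₀,μ₀) = 0, ∂_X² J continuous at (u₀,μ₀), and ∂_X² J(u₀,μ₀)[w,w] ≥ α‖w‖² for some α > 0 and all w ∈ X. Then there exist a convex open neighborhood U₀ × O₀ of (u₀,μ₀) and a continuous map u : O₀ → U₀ such that for each μ ∈ O₀ and w ∈ U₀ the following are equivalent: (a) w is a local minimizer of J(·,μ); (b) ∂_X J(w,μ) = 0; (c) w = u(μ). Moreover u(μ) is a global minimizer of J(·,μ) on U₀. -/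

import Mathlib

open Set Filter Topology

section StrongConvexity

variable {X : Type*} [NormedAddCommGroup X] [NormedSpace ℝ X] {S : Set X} {f : X → ℝ}
  {f' : X → X →L[ℝ] ℝ} {f'' : X → X →L[ℝ] X →L[ℝ] ℝ} {c : ℝ}

/-- A uniformly coercive second derivative makes the first derivative strongly monotone. -/
theorem strongly_monotone_of_coercive_hessian (hS : Convex ℝ S)
    (hf' : ∀ x ∈ S, HasFDerivAt f' (f'' x) x)
    (hc : ∀ x ∈ S, ∀ d, c * ‖d‖ ^ 2 ≤ f'' x d d) {x y : X} (hx : x ∈ S) (hy : y ∈ S) :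
    c * ‖y - x‖ ^ 2 ≤ (f' y - f' x) (y - x) := by
  set d := y - x with hd
  have hmem : ∀ t ∈ Icc (0 : ℝ) 1, x + t • d ∈ S := fun t ht => hS.add_smul_sub_mem hx hy ht
  have hg : ∀ t ∈ Icc (0 : ℝ) 1, HasDerivAt (fun t : ℝ => f' (x + t • d) d - c * ‖d‖ ^ 2 * t)
      (f'' (x + t • d) d d - c * ‖d‖ ^ 2) t := by
    intro t ht
    have h1 : HasDerivAt (fun t : ℝ => x + t • d) d t := by
      simpa using ((hasDerivAt_id t).smul_const d).const_add x
    have h2 : HasDerivAt (fun t : ℝ => f' (x + t • d) d) (f'' (x + t • d) d d) t :=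
      (ContinuousLinearMap.apply ℝ ℝ d).hasFDerivAt.comp_hasDerivAt t
        ((hf' _ (hmem t ht)).comp_hasDerivAt t h1)
    exact (h2.sub ((hasDerivAt_id t).const_mul (c * ‖d‖ ^ 2))).congr_deriv (by simp)
  have hmono : MonotoneOn (fun t : ℝ => f' (x + t • d) d - c * ‖d‖ ^ 2 * t) (Icc 0 1) := by
    refine monotoneOn_of_hasDerivWithinAt_nonneg (convex_Icc 0 1)
      (fun t ht => (hg t ht).continuousAt.continuousWithinAt)
      (fun t ht => (hg t (interior_subset ht)).hasDerivWithinAt) fun t ht => ?_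
    exact sub_nonneg.2 (hc _ (hmem t (interior_subset ht)) d)
  have h01 := hmono (left_mem_Icc.2 zero_le_one) (right_mem_Icc.2 zero_le_one) zero_le_one
  have hxy : x + d = y := by simp [hd]
  simp only [zero_smul, add_zero, mul_zero, sub_zero, one_smul, mul_one, hxy] at h01
  rw [sub_apply]
  linarith

/-- A strongly monotone derivative gives a quadratic lower bound by the tangent plane. -/
theorem quadratic_lower_bound_of_strongly_monotone (hS : Convex ℝ S)
    (hf : ∀ x ∈ S, HasFDerivAt f (f' x) x)
    (hm : ∀ x ∈ S, ∀ y ∈ S, c * ‖y - x‖ ^ 2 ≤ (f' y - f' x) (y - x))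
    {x y : X} (hx : x ∈ S) (hy : y ∈ S) :
    f x + f' x (y - x) + c / 2 * ‖y - x‖ ^ 2 ≤ f y := by
  set d := y - x with hd
  have hmem : ∀ t ∈ Icc (0 : ℝ) 1, x + t • d ∈ S := fun t ht => hS.add_smul_sub_mem hx hy ht
  have hg : ∀ t ∈ Icc (0 : ℝ) 1,
      HasDerivAt (fun t : ℝ => f (x + t • d) - f' x d * t - c / 2 * ‖d‖ ^ 2 * t ^ 2)
        (f' (x + t • d) d - f' x d - c * ‖d‖ ^ 2 * t) t := by
    intro t ht
    have h1 : HasDerivAt (fun t : ℝ => x + t • d) d t := by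
      simpa using ((hasDerivAt_id t).smul_const d).const_add x
    have h2 := (hf _ (hmem t ht)).comp_hasDerivAt t h1
    refine ((h2.sub ((hasDerivAt_id t).const_mul (f' x d))).sub
      ((hasDerivAt_pow 2 t).const_mul (c / 2 * ‖d‖ ^ 2))).congr_deriv ?_
    norm_num
    ring
  have hmono : MonotoneOn
      (fun t : ℝ => f (x + t • d) - f' x d * t - c / 2 * ‖d‖ ^ 2 * t ^ 2) (Icc 0 1) := by
    refine monotoneOn_of_hasDerivWithinAt_nonneg (convex_Icc 0 1)
      (fun t ht => (hg t ht).continuousAt.continuousWithinAt)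
      (fun t ht => (hg t (interior_subset ht)).hasDerivWithinAt) fun t ht => ?_
    rw [interior_Icc] at ht
    have h := hm x hx _ (hmem t (Ioo_subset_Icc_self ht))
    rw [add_sub_cancel_left, norm_smul, Real.norm_of_nonneg ht.1.le, map_smul, smul_eq_mul,
      sub_apply] at h
    have h' : t * (c * ‖d‖ ^ 2 * t) ≤ t * (f' (x + t • d) d - f' x d) := by linarith
    exact sub_nonneg.2 (le_of_mul_le_mul_left h' ht.1)
  have h01 := hmono (left_mem_Icc.2 zero_le_one) (right_mem_Icc.2 zero_le_one) zero_le_one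
  have hxy : x + d = y := by simp [hd]
  simp only [zero_smul, add_zero, mul_zero, sub_zero, one_smul, mul_one, hxy, one_pow, ne_eq,
    OfNat.ofNat_ne_zero, not_false_eq_true, zero_pow] at h01
  linarith

/-- A function lying quadratically above its tangent planes attains its minimum on a closed
bounded convex set. -/
theorem exists_isMinOn_of_quadratic_lower_bound [CompleteSpace X] (hS : Convex ℝ S)
    (hSc : IsClosed S) (hSb : Bornology.IsBounded S) (hne : S.Nonempty) (hc : 0 < c)
    (hcont : ContinuousOn f S)
    (hq : ∀ x ∈ S, ∀ y ∈ S, f x + f' x (y - x) + c / 2 * ‖y - x‖ ^ 2 ≤ f y) :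
    ∃ x ∈ S, IsMinOn f S x := by
  obtain ⟨a, ha⟩ := hne
  have hbdd : BddBelow (f '' S) := by
    obtain ⟨R, hR⟩ := hSb.subset_closedBall a
    refine ⟨f a - ‖f' a‖ * R, ?_⟩
    rintro _ ⟨y, hy, rfl⟩
    have h1 : -(‖f' a‖ * R) ≤ f' a (y - a) := by
      have h2 := (f' a).le_opNorm (y - a)
      have h3 : ‖y - a‖ ≤ R := mem_closedBall_iff_norm.1 (hR hy)
      have h4 := mul_le_mul_of_nonneg_left h3 (norm_nonneg (f' a))
      have h5 := neg_abs_le (f' a (y - a))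
      rw [Real.norm_eq_abs] at h2
      linarith
    have h6 : 0 ≤ c / 2 * ‖y - a‖ ^ 2 := by positivity
    linarith [hq a ha y hy]
  set m := sInf (f '' S)
  have hmle : ∀ x ∈ S, m ≤ f x := fun x hx => csInf_le hbdd (mem_image_of_mem f hx)
  have hmid : ∀ x ∈ S, ∀ y ∈ S, ∀ ε, f x ≤ m + ε → f y ≤ m + ε → ‖x - y‖ ^ 2 ≤ 8 / c * ε := by
    intro x hx y hy ε hxε hyε
    set z := midpoint ℝ x y
    have hz : z ∈ S := hS.midpoint_mem hx hy
    have hxz : x - z = (2⁻¹ : ℝ) • (x - y) := by simp [z, left_sub_midpoint]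
    have hyz : y - z = -((2⁻¹ : ℝ) • (x - y)) := by
      rw [← smul_neg, neg_sub]; simp [z, right_sub_midpoint]
    have h1 := hq z hz x hx
    have h2 := hq z hz y hy
    rw [hxz, norm_smul, Real.norm_of_nonneg (by norm_num)] at h1
    rw [hyz, norm_neg, map_neg, norm_smul, Real.norm_of_nonneg (by norm_num)] at h2
    have h3 := hmle z hz
    rw [div_mul_eq_mul_div, le_div_iff₀ hc]
    nlinarith
  have hseq : ∀ n : ℕ, ∃ x ∈ S, f x ≤ m + 1 / ((n : ℝ) + 1) := by
    intro n
    obtain ⟨_, ⟨x, hx, rfl⟩, hlt⟩ := exists_lt_of_csInf_lt (Set.Nonempty.image f ⟨a, ha⟩)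
      (lt_add_of_pos_right m (Nat.one_div_pos_of_nat (α := ℝ) (n := n)))
    exact ⟨x, hx, hlt.le⟩
  choose x hxS hxm using hseq
  have hcauchy : CauchySeq x := by
    refine cauchySeq_of_le_tendsto_0 (fun n : ℕ => √(8 / c * (1 / ((n : ℝ) + 1)))) ?_ ?_
    · intro n k N hn hk
      have hle : ∀ j : ℕ, N ≤ j → f (x j) ≤ m + 1 / ((N : ℝ) + 1) := fun j hj =>
        (hxm j).trans (by gcongr)
      rw [dist_eq_norm]
      exact Real.le_sqrt_of_sq_le (hmid _ (hxS n) _ (hxS k) _ (hle n hn) (hle k hk))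
    · have h := (tendsto_one_div_add_atTop_nhds_zero_nat (𝕜 := ℝ)).const_mul (8 / c)
      simpa [Function.comp_def] using (Real.continuous_sqrt.tendsto _).comp h
  obtain ⟨y, hy⟩ := cauchySeq_tendsto_of_complete hcauchy
  have hyS : y ∈ S := hSc.mem_of_tendsto hy (Eventually.of_forall hxS)
  refine ⟨y, hyS, fun z hz => ?_⟩
  have hlim : Tendsto (fun n => f (x n)) atTop (𝓝 (f y)) :=
    (hcont y hyS).tendsto.comp
      (tendsto_nhdsWithin_iff.2 ⟨hy, Eventually.of_forall hxS⟩)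
  have hlim' : Tendsto (fun n : ℕ => m + 1 / ((n : ℝ) + 1)) atTop (𝓝 m) := by
    simpa using (tendsto_one_div_add_atTop_nhds_zero_nat (𝕜 := ℝ)).const_add m
  exact (le_of_tendsto_of_tendsto' hlim hlim' hxm).trans (hmle z hz)

/-- A function lying quadratically above its tangent planes on a closed ball, whose derivative at
the centre is small, attains its minimum over the closed ball in the open ball. -/
theorem exists_isMinOn_mem_ball [CompleteSpace X] {a : X} {r : ℝ} (hr : 0 < r) (hc : 0 < c)
    (hcont : ContinuousOn f (Metric.closedBall a r))
    (hq : ∀ x ∈ Metric.closedBall a r, ∀ y ∈ Metric.closedBall a r,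
      f x + f' x (y - x) + c / 2 * ‖y - x‖ ^ 2 ≤ f y)
    (ha : ‖f' a‖ < c / 2 * r) :
    ∃ x ∈ Metric.ball a r, IsMinOn f (Metric.closedBall a r) x := by
  have haS : a ∈ Metric.closedBall a r := Metric.mem_closedBall_self hr.le
  obtain ⟨x, hx, hmin⟩ := exists_isMinOn_of_quadratic_lower_bound (convex_closedBall a r)
    Metric.isClosed_closedBall Metric.isBounded_closedBall ⟨a, haS⟩ hc hcont hq
  refine ⟨x, ?_, hmin⟩
  rw [mem_ball_iff_norm]
  refine (mem_closedBall_iff_norm.1 hx).lt_of_ne fun hxr => ?_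
  have h1 := hq a haS x hx
  have h2 : f x ≤ f a := hmin haS
  have h3 := (f' a).le_opNorm (x - a)
  have h4 := neg_abs_le (f' a (x - a))
  rw [Real.norm_eq_abs] at h3
  rw [hxr] at h1 h3
  have h5 := mul_lt_mul_of_pos_right ha hr
  nlinarith

end StrongConvexity

/-- **Local-minimizer existence theorem** (Theorem 2.4 of Kimura–Wakano).
`X`, `M` real Banach spaces, `U ⊆ X`, `O ⊆ M` open, `J : U × O → ℝ` with
`J(·,μ) ∈ C²(U)` for each `μ` (first partial derivative `DXJ`, second partial
derivative `DXXJ`, continuous in `w` for each fixed `μ`), `∂_X J` continuous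
on `U × O` into `X'`, `u₀ ∈ U` with `∂_X J(u₀,μ₀) = 0`, `∂_X² J` continuous at
`(u₀,μ₀)`, and `∂_X² J(u₀,μ₀)[w,w] ≥ α‖w‖²` for some `α > 0` and all `w ∈ X`.
Then there exist a convex open neighborhood `U₀ × O₀` of `(u₀,μ₀)` and a
continuous map `u : O₀ → U₀` such that for each `μ ∈ O₀` and `w ∈ U₀` the
following are equivalent: (a) `w` is a local minimizer of `J(·,μ)`;
(b) `∂_X J(w,μ) = 0`; (c) `w = u μ`.  Moreover `u μ` is a global minimizer of
`J(·,μ)` on `U₀`. -/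
theorem local_minimizer_existence
    {X M : Type*} [NormedAddCommGroup X] [NormedSpace ℝ X] [CompleteSpace X]
    [NormedAddCommGroup M] [NormedSpace ℝ M] [CompleteSpace M]
    (U : Set X) (O : Set M) (hU : IsOpen U) (hO : IsOpen O)
    (J : X → M → ℝ) (DXJ : X → M → (X →L[ℝ] ℝ))
    (DXXJ : X → M → (X →L[ℝ] X →L[ℝ] ℝ))
    (u₀ : X) (μ₀ : M) (hu₀U : u₀ ∈ U) (hμ₀O : μ₀ ∈ O)
    (hJd1 : ∀ μ ∈ O, ∀ w ∈ U, HasFDerivAt (fun v => J v μ) (DXJ w μ) w)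
    (hJd2 : ∀ μ ∈ O, ∀ w ∈ U, HasFDerivAt (fun v => DXJ v μ) (DXXJ w μ) w)
    (hJ2c : ∀ μ ∈ O, ContinuousOn (fun v => DXXJ v μ) U)
    (hDXc : ContinuousOn (fun p : X × M => DXJ p.1 p.2) (U ×ˢ O))
    (hcrit : DXJ u₀ μ₀ = 0)
    (hDXXc : ContinuousAt (fun p : X × M => DXXJ p.1 p.2) (u₀, μ₀))
    (α : ℝ) (hα : 0 < α)
    (hcoer : ∀ w : X, α * ‖w‖ ^ 2 ≤ DXXJ u₀ μ₀ w w) :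
    ∃ (U₀ : Set X) (O₀ : Set M) (u : M → X),
      IsOpen U₀ ∧ IsOpen O₀ ∧ Convex ℝ U₀ ∧ Convex ℝ O₀ ∧
      u₀ ∈ U₀ ∧ μ₀ ∈ O₀ ∧ U₀ ⊆ U ∧ O₀ ⊆ O ∧
      ContinuousOn u O₀ ∧ MapsTo u O₀ U₀ ∧
      (∀ μ ∈ O₀, ∀ w ∈ U₀,
        (IsLocalMin (fun v => J v μ) w ↔ DXJ w μ = 0) ∧
        (DXJ w μ = 0 ↔ w = u μ)) ∧
      (∀ μ ∈ O₀, ∀ w ∈ U₀, J (u μ) μ ≤ J w μ) := by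
  set c := α / 2 with hc_def
  have hc : 0 < c := half_pos hα
  obtain ⟨r, hr, δ, hδ, hball⟩ : ∃ r > 0, ∃ δ > 0, ∀ w ∈ Metric.closedBall u₀ r,
      ∀ μ ∈ Metric.ball μ₀ δ, w ∈ U ∧ μ ∈ O ∧ ‖DXXJ w μ - DXXJ u₀ μ₀‖ < c := by
    have h1 : ∀ᶠ p : X × M in 𝓝 (u₀, μ₀), p ∈ U ×ˢ O :=
      (hU.prod hO).mem_nhds ⟨hu₀U, hμ₀O⟩
    have h2 : ∀ᶠ p : X × M in 𝓝 (u₀, μ₀), ‖DXXJ p.1 p.2 - DXXJ u₀ μ₀‖ < c := by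
      filter_upwards [hDXXc (Metric.ball_mem_nhds (DXXJ u₀ μ₀) hc)] with p hp
      exact (mem_ball_iff_norm (a := DXXJ u₀ μ₀) (b := DXXJ p.1 p.2)).1 hp
    obtain ⟨ε, hε, h⟩ := Metric.eventually_nhds_iff.1 (h1.and h2)
    refine ⟨ε / 2, half_pos hε, ε, hε, fun w hw μ hμ => ?_⟩
    have hd : dist (w, μ) (u₀, μ₀) < ε := by
      rw [Prod.dist_eq]
      exact max_lt ((Metric.mem_closedBall.1 hw).trans_lt (half_lt_self hε)) hμ
    obtain ⟨hUO, hlt⟩ := h hd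
    exact ⟨hUO.1, hUO.2, hlt⟩
  have hu₀S : u₀ ∈ Metric.closedBall u₀ r := Metric.mem_closedBall_self hr.le
  have hcoer' : ∀ μ ∈ Metric.ball μ₀ δ, ∀ w ∈ Metric.closedBall u₀ r, ∀ d : X,
      c * ‖d‖ ^ 2 ≤ DXXJ w μ d d := by
    intro μ hμ w hw d
    have h1 := (DXXJ w μ - DXXJ u₀ μ₀).le_opNorm₂ d d
    have h2 := mul_le_mul_of_nonneg_right (hball w hw μ hμ).2.2.le (sq_nonneg ‖d‖)
    have h3 := neg_abs_le ((DXXJ w μ - DXXJ u₀ μ₀) d d)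
    rw [Real.norm_eq_abs] at h1
    simp only [sub_apply] at h1 h3
    have h4 := hcoer d
    have h5 : α * ‖d‖ ^ 2 = 2 * (c * ‖d‖ ^ 2) := by rw [hc_def]; ring
    linarith
  have hmono : ∀ μ ∈ Metric.ball μ₀ δ, ∀ x ∈ Metric.closedBall u₀ r,
      ∀ y ∈ Metric.closedBall u₀ r, c * ‖y - x‖ ^ 2 ≤ (DXJ y μ - DXJ x μ) (y - x) :=
    fun μ hμ x hx y hy => strongly_monotone_of_coercive_hessian (convex_closedBall u₀ r)
      (fun w hw => hJd2 μ (hball w hw μ hμ).2.1 w (hball w hw μ hμ).1) (hcoer' μ hμ) hx hy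
  have hcontAt : ∀ w ∈ Metric.closedBall u₀ r, ∀ μ ∈ Metric.ball μ₀ δ,
      ContinuousAt (fun ν => DXJ w ν) μ := by
    intro w hw μ hμ
    have h := hDXc.continuousAt
      ((hU.prod hO).mem_nhds (⟨(hball w hw μ hμ).1, (hball w hw μ hμ).2.1⟩ : (w, μ) ∈ U ×ˢ O))
    exact ContinuousAt.comp (f := fun ν : M => (w, ν)) h (by fun_prop)
  obtain ⟨η, hη, hsmall⟩ : ∃ η > 0, ∀ μ ∈ Metric.ball μ₀ η, ‖DXJ u₀ μ‖ < c / 2 * r := by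
    have h := (hcontAt u₀ hu₀S μ₀ (Metric.mem_ball_self hδ)).norm.tendsto.eventually_lt_const
      (u := c / 2 * r) (by rw [hcrit, norm_zero]; positivity)
    obtain ⟨η, hη, h'⟩ := Metric.eventually_nhds_iff.1 h
    exact ⟨η, hη, fun μ hμ => h' hμ⟩
  have hO₀δ : Metric.ball μ₀ (min δ η) ⊆ Metric.ball μ₀ δ :=
    Metric.ball_subset_ball (min_le_left _ _)
  have hmin : ∀ μ ∈ Metric.ball μ₀ (min δ η), ∃ x ∈ Metric.ball u₀ r,
      IsMinOn (fun v => J v μ) (Metric.closedBall u₀ r) x := by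
    intro μ hμ
    have hd : ∀ w ∈ Metric.closedBall u₀ r, HasFDerivAt (fun v => J v μ) (DXJ w μ) w :=
      fun w hw => hJd1 μ (hball w hw μ (hO₀δ hμ)).2.1 w (hball w hw μ (hO₀δ hμ)).1
    exact exists_isMinOn_mem_ball (f' := fun v => DXJ v μ) hr hc
      (fun w hw => (hd w hw).continuousAt.continuousWithinAt)
      (fun x hx y hy => quadratic_lower_bound_of_strongly_monotone (f' := fun v => DXJ v μ)
        (convex_closedBall u₀ r) hd (hmono μ (hO₀δ hμ)) hx hy)
      (hsmall μ (Metric.ball_subset_ball (min_le_right _ _) hμ))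
  choose! u hu humin using hmin
  have hlocal : ∀ μ ∈ Metric.ball μ₀ (min δ η), IsLocalMin (fun v => J v μ) (u μ) := fun μ hμ =>
    (humin μ hμ).isLocalMin (Metric.closedBall_mem_nhds_of_mem (hu μ hμ))
  have hcritical : ∀ μ ∈ Metric.ball μ₀ (min δ η), ∀ w ∈ Metric.ball u₀ r,
      IsLocalMin (fun v => J v μ) w → DXJ w μ = 0 := by
    intro μ hμ w hw hloc
    have h := hball w (Metric.ball_subset_closedBall hw) μ (hO₀δ hμ)
    exact hloc.hasFDerivAt_eq_zero (hJd1 μ h.2.1 w h.1)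
  have hest : ∀ μ ∈ Metric.ball μ₀ (min δ η), ∀ w ∈ Metric.ball u₀ r,
      c * ‖w - u μ‖ ≤ ‖DXJ w μ‖ := by
    intro μ hμ w hw
    have h1 := hmono μ (hO₀δ hμ) (u μ) (Metric.ball_subset_closedBall (hu μ hμ)) w
      (Metric.ball_subset_closedBall hw)
    rw [hcritical μ hμ (u μ) (hu μ hμ) (hlocal μ hμ), sub_zero] at h1
    have h2 := (le_abs_self _).trans ((DXJ w μ).le_opNorm (w - u μ))
    rcases (norm_nonneg (w - u μ)).eq_or_lt with h0 | hpos
    · rw [← h0, mul_zero]; exact norm_nonneg _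
    · refine le_of_mul_le_mul_right ?_ hpos
      linarith
  refine ⟨Metric.ball u₀ r, Metric.ball μ₀ (min δ η), u, Metric.isOpen_ball, Metric.isOpen_ball,
    convex_ball _ _, convex_ball _ _, Metric.mem_ball_self hr,
    Metric.mem_ball_self (lt_min hδ hη),
    fun w hw => (hball w (Metric.ball_subset_closedBall hw) μ₀ (Metric.mem_ball_self hδ)).1,
    fun μ hμ => (hball u₀ hu₀S μ (hO₀δ hμ)).2.1, ?_, hu, ?_,
    fun μ hμ w hw => humin μ hμ (Metric.ball_subset_closedBall hw)⟩
  · intro μ hμ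
    have hlim : Tendsto (fun ν => ‖DXJ (u μ) ν‖ / c) (𝓝[Metric.ball μ₀ (min δ η)] μ) (𝓝 0) := by
      have h := (hcontAt (u μ) (Metric.ball_subset_closedBall (hu μ hμ)) μ (hO₀δ hμ)).norm.tendsto
      rw [hcritical μ hμ (u μ) (hu μ hμ) (hlocal μ hμ), norm_zero] at h
      simpa using (h.mono_left nhdsWithin_le_nhds).div_const c
    refine tendsto_iff_dist_tendsto_zero.2
      (squeeze_zero' (Eventually.of_forall fun _ => dist_nonneg) ?_ hlim)
    filter_upwards [self_mem_nhdsWithin] with ν hν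
    rw [le_div_iff₀' hc, dist_comm, dist_eq_norm]
    exact hest ν hν (u μ) (hu μ hμ)
  · intro μ hμ w hw
    have huniq : DXJ w μ = 0 → w = u μ := by
      intro h0
      have h := hest μ hμ w hw
      rw [h0, norm_zero] at h
      exact sub_eq_zero.1 (norm_le_zero_iff.1 (nonpos_of_mul_nonpos_right h hc))
    refine ⟨⟨hcritical μ hμ w hw, fun h0 => huniq h0 ▸ hlocal μ hμ⟩, huniq, ?_⟩
    rintro rfl
    exact hcritical μ hμ _ hw (hlocal μ hμ)
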